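/- arXiv:2505.00882 — 2 statements merged into one kernel-verified Lean document; each statement's English description precedes it below -/
import Mathlib

section
/- Let 𝔔 be the quasi-classical set of states generated by (X,𝔉,ω̃) and let 𝔖₀ be a convex subset of 𝔖(ℋ) such that whenever ϱ ∈ 𝔖₀ ∩ 𝔔 and ς ∈ 𝔔 satisfies cς ≤ ϱ for some c > 0, one has ς ∈ 𝔖₀. Let f be an LAA function on 𝔖₀ with control functions a_f, b_f, taking values in (−∞,+∞]. Let ρ and σ be states in 𝔔 ∩ 𝔖₀ with representing measures μ_ρ and μ_σ, and set ε = TV(μ_ρ,μ_σ). If f(ρ) < +∞, then f(ρ) − f(σ) ≤ ε·C_f(ρ,σ|ε) + a_f(ε) + b_f(ε), where C_f(ρ,σ|ε) := sup{ f(Ω(μ)) − f(Ω(ν)) : μ,ν ∈ 𝒫(X), εμ ≤ μ_ρ, εν ≤ μ_σ, μ ⊥ ν } (the left-hand side may equal −∞). Moreover, if f is nonnegative, the same inequality holds with C_f(ρ,σ|ε) replaced by C_f⁺(ρ|ε) := sup{ f(Ω(μ)) : μ ∈ 𝒫(X), εμ ≤ μ_ρ }. -/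
open scoped ENNReal InnerProductSpace
open MeasureTheory

noncomputable section

namespace AFW

attribute [local instance] Classical.propDecidable

variable {𝓗 : Type*} [NormedAddCommGroup 𝓗] [InnerProductSpace ℂ 𝓗] [CompleteSpace 𝓗]

/-- Trace-type functional: on positive operators it is the trace; on self-adjoint
trace-class operators it is the trace norm `‖·‖₁`. -/
def trNorm (T : 𝓗 →L[ℂ] 𝓗) : ℝ≥0∞ :=
  ⨆ (s : Set 𝓗) (_ : Orthonormal ℂ (Subtype.val : s → 𝓗)),
    ∑' x : s, (‖⟪(x : 𝓗), T x⟫_ℂ‖₊ : ℝ≥0∞)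

/-- `ρ` is a quantum state: a positive (trace-class) operator with unit trace. -/
def IsState (ρ : 𝓗 →L[ℂ] 𝓗) : Prop := ρ.IsPositive ∧ trNorm ρ = 1

/-- `ρ ∧ εI` (spectral cut-off from above). -/
def cut (ρ : 𝓗 →L[ℂ] 𝓗) (ε : ℝ) : 𝓗 →L[ℂ] 𝓗 := cfc (fun x : ℝ => min x ε) ρ

/-- `[ρ − εI]₊`. -/
def cutAbove (ρ : 𝓗 →L[ℂ] 𝓗) (ε : ℝ) : 𝓗 →L[ℂ] 𝓗 := cfc (fun x : ℝ => max (x - ε) 0) ρ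

/-- positive part `[T]₊` of a self-adjoint operator. -/
def posP (T : 𝓗 →L[ℂ] 𝓗) : 𝓗 →L[ℂ] 𝓗 := cfc (fun x : ℝ => max x 0) T

/-- negative part `[T]₋` of a self-adjoint operator. -/
def negP (T : 𝓗 →L[ℂ] 𝓗) : 𝓗 →L[ℂ] 𝓗 := cfc (fun x : ℝ => max (-x) 0) T

def sqrtOp (T : 𝓗 →L[ℂ] 𝓗) : 𝓗 →L[ℂ] 𝓗 := cfc Real.sqrt T

def eta (x : ℝ) : ℝ := -(x * Real.log x)

/-- The von Neumann entropy `S(ρ) = Tr η(ρ)`, with values in `[0,+∞]`. -/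
def entropy (ρ : 𝓗 →L[ℂ] 𝓗) : ℝ≥0∞ := trNorm (cfc eta ρ)

/-- Homogeneous extension `S̃` of the von Neumann entropy to the positive cone. -/
def entExt (ρ : 𝓗 →L[ℂ] 𝓗) : ℝ≥0∞ :=
  if ρ = 0 then 0 else trNorm ρ * entropy ((trNorm ρ).toReal⁻¹ • ρ)

def binEnt (p : ℝ) : ℝ := eta p + eta (1 - p)

def binEntUp (x : ℝ) : ℝ := if x ≤ 1 / 2 then binEnt x else Real.log 2

def etaUp (x : ℝ) : ℝ := if x ≤ (Real.exp 1)⁻¹ then eta x else (Real.exp 1)⁻¹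

/-- nondecreasing modification `a↑` used for control functions. -/
def up (a : ℝ → ℝ) (x : ℝ) : ℝ := if x ≤ 1 / 2 then a x else a (1 / 2)

/-- Control functions for LAA functions. -/
structure ControlPair (a b : ℝ → ℝ) : Prop where
  conta : ContinuousOn a (Set.Icc 0 1)
  contb : ContinuousOn b (Set.Icc 0 1)
  zeroa : a 0 = 0
  zerob : b 0 = 0
  cva : ConcaveOn ℝ (Set.Icc 0 (1 / 2)) a
  cvb : ConcaveOn ℝ (Set.Icc 0 (1 / 2)) b
  mona : MonotoneOn a (Set.Icc 0 (1 / 2))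
  monb : MonotoneOn b (Set.Icc 0 (1 / 2))

/-- `f` is locally almost affine on `S0` with control functions `a`, `b`. -/
def IsLAA (S0 : Set (𝓗 →L[ℂ] 𝓗)) (f : (𝓗 →L[ℂ] 𝓗) → EReal) (a b : ℝ → ℝ) : Prop :=
  ∀ ρ ∈ S0, ∀ σ ∈ S0, ∀ p : ℝ, 0 ≤ p → p ≤ 1 →
    ((p : EReal) * f ρ + ((1 - p : ℝ) : EReal) * f σ) - ((a p : ℝ) : EReal)
        ≤ f (p • ρ + (1 - p) • σ) ∧
      f (p • ρ + (1 - p) • σ)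
        ≤ ((p : EReal) * f ρ + ((1 - p : ℝ) : EReal) * f σ) + ((b p : ℝ) : EReal)

/-- Homogeneous extension of `f` to the cone generated by its domain. -/
def homExt (f : (𝓗 →L[ℂ] 𝓗) → EReal) (T : 𝓗 →L[ℂ] 𝓗) : EReal :=
  if T = 0 then 0 else (trNorm T : EReal) * f ((trNorm T).toReal⁻¹ • T)

/-- The barycenter `Ω(μ)` of the family `w` with respect to `μ`. -/
def Omega {X : Type*} [MeasurableSpace X] (w : X → 𝓗 →L[ℂ] 𝓗) (μ : Measure X) :
    𝓗 →L[ℂ] 𝓗 := ∫ x, w x ∂μ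

/-- The quasi-classical set of states generated by `(X, 𝔉, w)`. -/
def QSet {X : Type*} [MeasurableSpace X] (w : X → 𝓗 →L[ℂ] 𝓗) : Set (𝓗 →L[ℂ] 𝓗) :=
  {ρ | ∃ μ : Measure X, IsProbabilityMeasure μ ∧ ρ = Omega w μ}

/-- Total variation distance between measures. -/
def TV {X : Type*} [MeasurableSpace X] (μ ν : Measure X) : ℝ≥0∞ :=
  ⨆ (A : Set X) (_ : MeasurableSet A), (μ A - ν A) ⊔ (ν A - μ A)

/-- `Tr H ρ` for a positive operator `H = Σ h_k |τ_k⟩⟨τ_k|` given by discrete spectral data. -/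
def energy (h : ℕ → ℝ) (τ : ℕ → 𝓗) (ρ : 𝓗 →L[ℂ] 𝓗) : ℝ≥0∞ :=
  if LinearMap.range (ρ : 𝓗 →ₗ[ℂ] 𝓗) ≤ (Submodule.span ℂ (Set.range τ)).topologicalClosure
  then ∑' k, ENNReal.ofReal (h k * (⟪τ k, ρ (τ k)⟫_ℂ).re)
  else ⊤

/-- A positive operator with discrete spectral representation `Σ h_k |τ_k⟩⟨τ_k|`
(nondecreasing nonnegative eigenvalue sequence, orthonormal eigenvectors). -/
structure DiscreteOp (h : ℕ → ℝ) (τ : ℕ → 𝓗) : Prop where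
  ortho : Orthonormal ℂ τ
  nonneg : ∀ k, 0 ≤ h k
  mono : Monotone h

/-- The Gibbs condition `Tr e^{−βH} < ∞` for all `β > 0`. -/
def GibbsCondition (h : ℕ → ℝ) : Prop := ∀ β : ℝ, 0 < β → Summable fun k => Real.exp (-β * h k)

/-- `F_H(E) = sup { S(ρ) : Tr Hρ ≤ E }`. -/
def FH (h : ℕ → ℝ) (τ : ℕ → 𝓗) (E : ℝ≥0∞) : ℝ≥0∞ :=
  ⨆ (ϑ : 𝓗 →L[ℂ] 𝓗) (_ : IsState ϑ) (_ : energy h τ ϑ ≤ E), entropy ϑ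

/-- `Tr(ρ M)` for positive `ρ`, `M`, computed as `Tr(√ρ M √ρ)`. -/
def trPair (ρ M : 𝓗 →L[ℂ] 𝓗) : ℝ≥0∞ := trNorm (sqrtOp ρ * M * sqrtOp ρ)

/-- classical relative entropy of two finite tuples. -/
def klFin {n : ℕ} (p q : Fin n → ℝ) : ℝ≥0∞ :=
  if ∀ i, q i = 0 → p i = 0 then
    ENNReal.ofReal (∑ i, if p i = 0 then 0 else p i * Real.log (p i / q i))
  else ⊤

/-- The quantum relative entropy `D(ρ‖σ)`, realized as the supremum of classical
relative entropies of outcome distributions over all finite quantum measurements. -/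
def relEnt (ρ σ : 𝓗 →L[ℂ] 𝓗) : ℝ≥0∞ :=
  ⨆ (n : ℕ) (M : Fin n → 𝓗 →L[ℂ] 𝓗) (_ : ∀ i, (M i).IsPositive) (_ : ∑ i, M i = 1),
    klFin (fun i => (trPair ρ (M i)).toReal) (fun i => (trPair σ (M i)).toReal)

/-- rank of an operator (junk value `0` if infinite). -/
def opRank (T : 𝓗 →L[ℂ] 𝓗) : ℕ := Module.finrank ℂ (LinearMap.range (T : 𝓗 →ₗ[ℂ] 𝓗))

/-- a positive trace-preserving linear map (such as a partial trace). -/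
def IsMarginal {𝓚 : Type*} [NormedAddCommGroup 𝓚] [InnerProductSpace ℂ 𝓚] [CompleteSpace 𝓚]
    (Λ : (𝓗 →L[ℂ] 𝓗) →ₗ[ℂ] (𝓚 →L[ℂ] 𝓚)) : Prop :=
  (∀ T : 𝓗 →L[ℂ] 𝓗, T.IsPositive → (Λ T).IsPositive) ∧
  (∀ T : 𝓗 →L[ℂ] 𝓗, T.IsPositive → trNorm (Λ T) = trNorm T)

end AFW

namespace AFW

section

variable {𝓗 : Type*} [NormedAddCommGroup 𝓗] [InnerProductSpace ℂ 𝓗] [CompleteSpace 𝓗]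

/-- Any two finite measures split into a common part and two mutually singular excesses. -/
lemma exists_mutuallySingular_add {X : Type*} [MeasurableSpace X] (μ ν : Measure X)
    [IsFiniteMeasure μ] [IsFiniteMeasure ν] :
    ∃ α β κ : Measure X, μ = α + κ ∧ ν = β + κ ∧ α ⟂ₘ β := by
  obtain ⟨s, hs⟩ := exists_isHahnDecomposition μ ν
  have hm := hs.measurableSet
  have hμ : μ = μ.restrict s + μ.restrict sᶜ := (Measure.restrict_add_restrict_compl hm).symm
  have hν : ν = ν.restrict s + ν.restrict sᶜ := (Measure.restrict_add_restrict_compl hm).symm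
  refine ⟨μ.restrict sᶜ - ν.restrict sᶜ, ν.restrict s - μ.restrict s,
    ν.restrict sᶜ + μ.restrict s, ?_, ?_, ?_⟩
  · rw [← add_assoc, Measure.sub_add_cancel_of_le hs.ge_on_compl, add_comm]
    exact hμ
  · rw [add_comm (ν.restrict sᶜ), ← add_assoc, Measure.sub_add_cancel_of_le hs.le_on]
    exact hν
  · refine ⟨s, hm, ?_, ?_⟩
    · refine le_antisymm ((Measure.sub_le s).trans ?_) zero_le
      simp [Measure.restrict_apply hm]
    · refine le_antisymm ((Measure.sub_le sᶜ).trans ?_) zero_le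
      simp [Measure.restrict_apply hm.compl]

lemma TV_add_add_of_mutuallySingular {X : Type*} [MeasurableSpace X] {α β κ : Measure X}
    [IsFiniteMeasure κ] (hs : α ⟂ₘ β) (h : α Set.univ = β Set.univ) :
    TV (α + κ) (β + κ) = α Set.univ := by
  refine le_antisymm (iSup₂_le fun A _ => ?_) ?_
  · simp only [Measure.add_apply, sup_le_iff, tsub_le_iff_right]
    refine ⟨?_, ?_⟩
    · rw [← add_assoc]
      gcongr
      exact (measure_mono (Set.subset_univ A)).trans le_self_add
    · rw [← add_assoc, h]
      gcongr
      exact (measure_mono (Set.subset_univ A)).trans le_self_add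
  · obtain ⟨s, hm, hα, hβ⟩ := hs
    have hu : α sᶜ = α Set.univ := by rw [← measure_add_measure_compl hm, hα, zero_add]
    refine le_trans ?_ (le_iSup₂ (f := fun (A : Set X) (_ : MeasurableSet A) =>
      ((α + κ) A - (β + κ) A) ⊔ ((β + κ) A - (α + κ) A)) sᶜ hm.compl)
    refine le_trans ?_ le_sup_left
    simp only [Measure.add_apply, hβ, zero_add, hu]
    rw [ENNReal.add_sub_cancel_right (measure_ne_top κ _)]

/-- Decomposition of two probability measures at total variation distance `e > 0` into their
normalized excesses and a normalized common part. -/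
lemma exists_probability_decomposition {X : Type*} [MeasurableSpace X] (μ ν : Measure X)
    [IsProbabilityMeasure μ] [IsProbabilityMeasure ν] {e : ℝ≥0∞} (hTV : TV μ ν = e)
    (he : e ≠ 0) :
    e ≤ 1 ∧ ∃ α β κ : Measure X, IsProbabilityMeasure α ∧ IsProbabilityMeasure β ∧
      IsProbabilityMeasure κ ∧ α ⟂ₘ β ∧
      μ = e • α + (1 - e) • κ ∧ ν = e • β + (1 - e) • κ := by
  obtain ⟨α, β, κ, hμ, hν, hs⟩ := exists_mutuallySingular_add μ ν
  have hαu : α Set.univ + κ Set.univ = 1 := by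
    rw [← Measure.add_apply, ← hμ, measure_univ]
  have hβu : β Set.univ + κ Set.univ = 1 := by
    rw [← Measure.add_apply, ← hν, measure_univ]
  have hκt : κ Set.univ ≠ ⊤ := ne_top_of_le_ne_top ENNReal.one_ne_top (hαu ▸ le_add_self)
  have : IsFiniteMeasure κ := ⟨hκt.lt_top⟩
  have hαβ : α Set.univ = β Set.univ :=
    (ENNReal.add_left_inj hκt).1 (hαu.trans hβu.symm)
  have heα : α Set.univ = e := by
    rw [← hTV, hμ, hν, TV_add_add_of_mutuallySingular hs hαβ]
  have heβ : β Set.univ = e := hαβ ▸ heα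
  have he1 : e ≤ 1 := by rw [← heα, ← hαu]; exact le_self_add
  have het : e ≠ ⊤ := ne_top_of_le_ne_top ENNReal.one_ne_top he1
  have hκu : κ Set.univ = 1 - e := by
    rw [← hαu, heα, ENNReal.add_sub_cancel_left het]
  have hprob : ∀ {m : Measure X} {c : ℝ≥0∞}, m Set.univ = c → c ≠ 0 → c ≠ ⊤ →
      IsProbabilityMeasure (c⁻¹ • m) := fun hm h0 ht =>
    ⟨by rw [Measure.smul_apply, hm, smul_eq_mul, ENNReal.inv_mul_cancel h0 ht]⟩
  have hsmul : ∀ {m : Measure X} {c : ℝ≥0∞}, c ≠ 0 → c ≠ ⊤ → c • (c⁻¹ • m) = m :=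
    fun h0 ht => by rw [smul_smul, ENNReal.mul_inv_cancel h0 ht, one_smul]
  refine ⟨he1, e⁻¹ • α, e⁻¹ • β, if e = 1 then μ else (1 - e)⁻¹ • κ, hprob heα he het,
    hprob heβ he het, ?_, (hs.smul _).symm.smul _ |>.symm, ?_⟩
  · split_ifs with h
    · infer_instance
    · exact hprob hκu (tsub_pos_of_lt (lt_of_le_of_ne he1 h)).ne'
        (ne_top_of_le_ne_top ENNReal.one_ne_top tsub_le_self)
  · rw [hsmul he het, hsmul he het]
    suffices (1 - e) • (if e = 1 then μ else (1 - e)⁻¹ • κ) = κ by rw [this]; exact ⟨hμ, hν⟩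
    split_ifs with h
    · have : κ = 0 := by rw [← Measure.measure_univ_eq_zero, hκu, h, tsub_self]
      rw [h, tsub_self, zero_smul, this]
    · exact hsmul (tsub_pos_of_lt (lt_of_le_of_ne he1 h)).ne'
        (ne_top_of_le_ne_top ENNReal.one_ne_top tsub_le_self)

lemma Omega_nonneg {X : Type*} [MeasurableSpace X] {w : X → 𝓗 →L[ℂ] 𝓗}
    (hw : ∀ x, (w x).IsPositive) (μ : Measure X) : 0 ≤ Omega w μ :=
  integral_nonneg fun x => (ContinuousLinearMap.nonneg_iff_isPositive _).2 (hw x)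

lemma Omega_add_smul {X : Type*} [MeasurableSpace X] {w : X → 𝓗 →L[ℂ] 𝓗} {α κ : Measure X}
    (hα : Integrable w α) (hκ : Integrable w κ) {t : ℝ} (ht0 : 0 ≤ t) (ht1 : t ≤ 1) :
    Omega w (ENNReal.ofReal t • α + (1 - ENNReal.ofReal t) • κ) =
      t • Omega w α + (1 - t) • Omega w κ := by
  have h : 1 - ENNReal.ofReal t = ENNReal.ofReal (1 - t) := by
    rw [ENNReal.ofReal_sub _ ht0, ENNReal.ofReal_one]
  rw [h, Omega, integral_add_measure (hα.smul_measure ENNReal.ofReal_ne_top)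
    (hκ.smul_measure ENNReal.ofReal_ne_top), integral_smul_measure, integral_smul_measure,
    ENNReal.toReal_ofReal ht0, ENNReal.toReal_ofReal (sub_nonneg.2 ht1)]
  rfl

/-- If `x` and `y` are almost the mixtures of `p` and of `q` with a common `r`, then `x - y` is
almost at most `t * (p - q)`. -/
lemma sub_le_of_mixture_bounds {x y p q r : EReal} {t A B : ℝ} (ht0 : 0 < t) (ht1 : t ≤ 1)
    (hx : x ≠ ⊤) (hx' : x ≠ ⊥) (hp : p ≠ ⊥) (hq : q ≠ ⊥) (hr : r ≠ ⊥)
    (h₁ : (t : EReal) * p + ((1 - t : ℝ) : EReal) * r - (A : EReal) ≤ x)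
    (h₂ : x ≤ (t : EReal) * p + ((1 - t : ℝ) : EReal) * r + (B : EReal))
    (h₃ : (t : EReal) * q + ((1 - t : ℝ) : EReal) * r - (A : EReal) ≤ y) :
    x - y ≤ (t : EReal) * (p - q) + (A : EReal) + (B : EReal) := by
  wlog hrt : r ≠ ⊤ generalizing r
  · rw [not_not] at hrt
    subst hrt
    rcases ht1.lt_or_eq with h | rfl
    · exfalso
      have h0 : 0 < 1 - t := by linarith
      rw [EReal.coe_mul_top_of_pos h0] at h₁
      have : (t : EReal) * p ≠ ⊥ := by
        induction p with
        | bot => exact absurd rfl hp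
        | top => simp [EReal.coe_mul_top_of_pos ht0]
        | coe p => exact_mod_cast EReal.coe_ne_bot (t * p)
      rw [EReal.add_top_of_ne_bot this, EReal.top_sub_coe, top_le_iff] at h₁
      exact hx h₁
    · simp only [sub_self, EReal.coe_zero, zero_mul] at this h₁ h₂ h₃
      exact this (r := 0) (by simp) h₁ h₂ h₃ (by simp)
  lift r to ℝ using ⟨hrt, hr⟩
  lift x to ℝ using ⟨hx, hx'⟩
  have hpt : p ≠ ⊤ := by
    rintro rfl
    rw [EReal.coe_mul_top_of_pos ht0, ← EReal.coe_mul, EReal.top_add_coe, EReal.top_sub_coe,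
      top_le_iff] at h₁
    exact hx h₁
  lift p to ℝ using ⟨hpt, hp⟩
  induction y with
  | top => simp
  | bot =>
    exfalso
    rw [le_bot_iff] at h₃
    induction q with
    | bot => exact hq rfl
    | top =>
      rw [EReal.coe_mul_top_of_pos ht0, ← EReal.coe_mul, EReal.top_add_coe,
        EReal.top_sub_coe] at h₃
      simp at h₃
    | coe q => exact EReal.coe_ne_bot (t * q + (1 - t) * r - A) (by exact_mod_cast h₃)
  | coe y =>
    induction q with
    | bot => exact absurd rfl hq
    | top =>
      rw [EReal.coe_mul_top_of_pos ht0, ← EReal.coe_mul, EReal.top_add_coe,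
        EReal.top_sub_coe, top_le_iff] at h₃
      simp at h₃
    | coe q =>
      norm_cast at *
      linarith

/-- The estimate behind the AFW technique: for `ε > 0` the increment of `f` is controlled by a
single pair of mutually singular excess measures. -/
lemma exists_excess_bound {X : Type*} [MeasurableSpace X] {w : X → 𝓗 →L[ℂ] 𝓗}
    (hw_state : ∀ x, IsState (w x))
    (hw_int : ∀ μ : Measure X, IsProbabilityMeasure μ → Integrable w μ)
    {S0 : Set (𝓗 →L[ℂ] 𝓗)}
    (hSprop : ∀ ϱ ∈ S0 ∩ QSet w, ∀ ς ∈ QSet w, (∃ c : ℝ, 0 < c ∧ c • ς ≤ ϱ) → ς ∈ S0)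
    {f : (𝓗 →L[ℂ] 𝓗) → EReal} {a b : ℝ → ℝ}
    (hbot : ∀ ϱ ∈ S0, f ϱ ≠ ⊥) (hLAA : IsLAA S0 f a b)
    {μρ μσ : Measure X} [IsProbabilityMeasure μρ] [IsProbabilityMeasure μσ]
    (hρ : Omega w μρ ∈ S0) (hσ : Omega w μσ ∈ S0)
    {ε : ℝ} (hε : 0 < ε) (hTV : TV μρ μσ = ENNReal.ofReal ε) (hfρ : f (Omega w μρ) ≠ ⊤) :
    ∃ μ ν : Measure X, IsProbabilityMeasure μ ∧ IsProbabilityMeasure ν ∧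
      ENNReal.ofReal ε • μ ≤ μρ ∧ ENNReal.ofReal ε • ν ≤ μσ ∧ μ ⟂ₘ ν ∧
      Omega w ν ∈ S0 ∧
      f (Omega w μρ) - f (Omega w μσ) ≤
        (ε : EReal) * (f (Omega w μ) - f (Omega w ν)) + ((a ε : ℝ) : EReal)
          + ((b ε : ℝ) : EReal) := by
  obtain ⟨he1, α, β, κ, hα, hβ, hκ, hs, hμ, hν⟩ :=
    exists_probability_decomposition μρ μσ hTV (ENNReal.ofReal_pos.2 hε).ne'
  have hε1 : ε ≤ 1 := ENNReal.ofReal_le_one.1 he1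
  have hdρ : Omega w μρ = ε • Omega w α + (1 - ε) • Omega w κ := by
    conv_lhs => rw [hμ]
    exact Omega_add_smul (hw_int _ hα) (hw_int _ hκ) hε.le hε1
  have hdσ : Omega w μσ = ε • Omega w β + (1 - ε) • Omega w κ := by
    conv_lhs => rw [hν]
    exact Omega_add_smul (hw_int _ hβ) (hw_int _ hκ) hε.le hε1
  have hpos : ∀ m : Measure X, 0 ≤ Omega w m := Omega_nonneg fun x => (hw_state x).1
  have hQ : ∀ m : Measure X, IsProbabilityMeasure m → Omega w m ∈ QSet w :=
    fun m hm => ⟨m, hm, rfl⟩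
  have hαS : Omega w α ∈ S0 := hSprop _ ⟨hρ, hQ _ inferInstance⟩ _ (hQ _ hα)
    ⟨ε, hε, by rw [hdρ]; exact le_add_of_nonneg_right (smul_nonneg (sub_nonneg.2 hε1) (hpos _))⟩
  have hβS : Omega w β ∈ S0 := hSprop _ ⟨hσ, hQ _ inferInstance⟩ _ (hQ _ hβ)
    ⟨ε, hε, by rw [hdσ]; exact le_add_of_nonneg_right (smul_nonneg (sub_nonneg.2 hε1) (hpos _))⟩
  refine ⟨α, β, hα, hβ, ?_, ?_, hs, hβS, ?_⟩
  · conv_rhs => rw [hμ]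
    exact Measure.le_add_right le_rfl
  · conv_rhs => rw [hν]
    exact Measure.le_add_right le_rfl
  obtain ⟨κ', hκ', hdρ', hdσ'⟩ : ∃ ω ∈ S0, Omega w μρ = ε • Omega w α + (1 - ε) • ω ∧
      Omega w μσ = ε • Omega w β + (1 - ε) • ω := by
    rcases hε1.lt_or_eq with h | rfl
    · refine ⟨Omega w κ, hSprop _ ⟨hρ, hQ _ inferInstance⟩ _ (hQ _ hκ) ⟨1 - ε, sub_pos.2 h, ?_⟩,
        hdρ, hdσ⟩
      rw [hdρ]
      exact le_add_of_nonneg_left (smul_nonneg hε.le (hpos _))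
    · exact ⟨Omega w μρ, hρ, by simpa using hdρ, by simpa using hdσ⟩
  have h₁ := hLAA _ hαS _ hκ' ε hε.le hε1
  have h₃ := (hLAA _ hβS _ hκ' ε hε.le hε1).1
  rw [← hdρ'] at h₁
  rw [← hdσ'] at h₃
  exact sub_le_of_mixture_bounds hε hε1 hfρ (hbot _ hρ) (hbot _ hαS) (hbot _ hβS) (hbot _ hκ')
    h₁.1 h₁.2 h₃

lemma eq_of_TV_eq_zero {X : Type*} [MeasurableSpace X] {μ ν : Measure X} (h : TV μ ν = 0) :
    μ = ν := by
  ext A hA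
  have := (iSup₂_le_iff (f := fun (A : Set X) (_ : MeasurableSet A) =>
    (μ A - ν A) ⊔ (ν A - μ A))).1 h.le A hA
  exact le_antisymm (tsub_nonpos.1 (le_sup_left.trans this))
    (tsub_nonpos.1 (le_sup_right.trans this))

end

/-- advanced AFW lemma in the quasi-classical settings, Lemma 2 of the paper. -/
theorem stmt0
    {𝓗 : Type*} [NormedAddCommGroup 𝓗] [InnerProductSpace ℂ 𝓗] [CompleteSpace 𝓗]
    {X : Type*} [MeasurableSpace X] (w : X → 𝓗 →L[ℂ] 𝓗)
    (hw_state : ∀ x, IsState (w x))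
    (hw_int : ∀ μ : Measure X, IsProbabilityMeasure μ → Integrable w μ)
    (S0 : Set (𝓗 →L[ℂ] 𝓗)) (hS0 : S0 ⊆ {ϱ | IsState ϱ}) (hconv : Convex ℝ S0)
    (hSprop : ∀ ϱ ∈ S0 ∩ QSet w, ∀ ς ∈ QSet w, (∃ c : ℝ, 0 < c ∧ c • ς ≤ ϱ) → ς ∈ S0)
    (f : (𝓗 →L[ℂ] 𝓗) → EReal) (a b : ℝ → ℝ) (hab : ControlPair a b)
    (hbot : ∀ ϱ ∈ S0, f ϱ ≠ ⊥) (hLAA : IsLAA S0 f a b)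
    (ρ σ : 𝓗 →L[ℂ] 𝓗) (hρ : ρ ∈ QSet w ∩ S0) (hσ : σ ∈ QSet w ∩ S0)
    (μρ μσ : Measure X) (hμρP : IsProbabilityMeasure μρ) (hμσP : IsProbabilityMeasure μσ)
    (hμρ : ρ = Omega w μρ) (hμσ : σ = Omega w μσ)
    (ε : ℝ) (hε0 : 0 ≤ ε) (hTV : TV μρ μσ = ENNReal.ofReal ε)
    (hfρ : f ρ ≠ ⊤) :
    f ρ - f σ ≤
      (ε : EReal) *
        (⨆ (μ : Measure X) (ν : Measure X) (_ : IsProbabilityMeasure μ)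
          (_ : IsProbabilityMeasure ν) (_ : ENNReal.ofReal ε • μ ≤ μρ)
          (_ : ENNReal.ofReal ε • ν ≤ μσ) (_ : μ ⟂ₘ ν),
            (f (Omega w μ) - f (Omega w ν)))
      + ((a ε : ℝ) : EReal) + ((b ε : ℝ) : EReal) ∧
    ((∀ ϱ ∈ S0, 0 ≤ f ϱ) →
      f ρ - f σ ≤
        (ε : EReal) *
          (⨆ (μ : Measure X) (_ : IsProbabilityMeasure μ)
            (_ : ENNReal.ofReal ε • μ ≤ μρ), f (Omega w μ))
        + ((a ε : ℝ) : EReal) + ((b ε : ℝ) : EReal)) := by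
  subst hμρ hμσ
  rcases hε0.eq_or_lt with rfl | hε
  · obtain rfl := eq_of_TV_eq_zero (hTV.trans ENNReal.ofReal_zero)
    simp [hab.zeroa, hab.zerob, EReal.sub_self_le_zero]
  obtain ⟨μ, ν, hμ, hν, hμle, hνle, hs, hνS, hle⟩ :=
    exists_excess_bound hw_state hw_int hSprop hbot hLAA hρ.2 hσ.2 hε hTV hfρ
  have hε' : (0 : EReal) ≤ (ε : EReal) := by exact_mod_cast hε0
  refine ⟨hle.trans ?_, fun hf => hle.trans ?_⟩
  · gcongr
    exact le_iSup_of_le μ <| le_iSup_of_le ν <| le_iSup_of_le hμ <| le_iSup_of_le hν <|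
      le_iSup_of_le hμle <| le_iSup_of_le hνle <| le_iSup_of_le hs le_rfl
  · gcongr
    refine le_trans ?_ (le_iSup_of_le μ <| le_iSup_of_le hμ <| le_iSup_of_le hμle le_rfl)
    simpa using EReal.sub_le_sub (le_refl (f (Omega w μ))) (hf _ hνS)

end AFW
end
end

section
/- Let 𝔖₀ be a convex subset of 𝔖(ℋ) such that whenever ϱ ∈ 𝔖₀, ς is a state with cς ≤ ϱ for some c > 0 and [ϱ,ς] = 0, one has ς ∈ 𝔖₀. Let f be an LAA function on 𝔖₀ with control functions a_f, b_f, taking values in [0,+∞]. If f(ρ) < +∞ then f(ρ) − f(σ) ≤ f̃(ρ∧εI) + 2a_f↑(ε) + b_f↑(ε) for any state σ ∈ 𝔖₀ such that [ρ,σ] = 0 and ½‖ρ−σ‖₁ ≤ ε ≤ 1, where f̃ is the homogeneous extension of f, a_f↑(ε) := a_f(ε) for ε ∈ [0,1/2] and a_f↑(ε) := a_f(1/2) for ε ∈ (1/2,1], and similarly for b_f↑. -/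
open scoped ENNReal InnerProductSpace
open MeasureTheory

noncomputable section

namespace AFW

attribute [local instance] Classical.propDecidable

variable {𝓗 : Type*} [NormedAddCommGroup 𝓗] [InnerProductSpace ℂ 𝓗] [CompleteSpace 𝓗]

end AFW

namespace AFW

section CStar

variable {A : Type*} [CStarAlgebra A] [PartialOrder A] [StarOrderedRing A]

/-- For commuting nonnegative elements, `(x - y)⁺ ≤ x`. -/
lemma posPart_sub_le_left {x y : A} (hx : 0 ≤ x) (hy : 0 ≤ y) (h : Commute x y) :
    (x - y)⁺ ≤ x := by
  have hsx : IsSelfAdjoint x := .of_nonneg hx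
  have hsy : IsSelfAdjoint y := .of_nonneg hy
  have hxy : 0 ≤ x * y := h.mul_nonneg hx hy
  have hsub : IsSelfAdjoint (x - y) := hsx.sub hsy
  have habs : CFC.abs (x - y) ≤ x + y := by
    have h1 : star (x - y) * (x - y) ≤ (x + y) * (x + y) := by
      rw [hsub.star_eq, ← sub_nonneg]
      have : (x + y) * (x + y) - (x - y) * (x - y) = (4 : ℕ) • (x * y) := by
        have := h.eq
        simp only [add_mul, mul_add, sub_mul, mul_sub, ← this]
        abel
      rw [this]
      exact nsmul_nonneg hxy 4
    calc CFC.abs (x - y) = CFC.sqrt (star (x - y) * (x - y)) := rfl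
      _ ≤ CFC.sqrt ((x + y) * (x + y)) := CFC.sqrt_le_sqrt _ _ h1
      _ = x + y := CFC.sqrt_mul_self _ (add_nonneg hx hy)
  have h2 : 2 • (x - y)⁺ ≤ 2 • x := by
    rw [← CFC.abs_add_self (x - y) hsub]
    calc CFC.abs (x - y) + (x - y) ≤ (x + y) + (x - y) := by gcongr
      _ = 2 • x := by abel
  have h3 := smul_le_smul_of_nonneg_left h2 (by norm_num : (0 : ℝ) ≤ 1 / 2)
  have h4 : ∀ z : A, (1 / 2 : ℝ) • (2 • z) = z := fun z => by
    rw [← Nat.cast_smul_eq_nsmul ℝ, smul_smul]; norm_num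
  rwa [h4, h4] at h3

end CStar

variable {𝓗 : Type*} [NormedAddCommGroup 𝓗] [InnerProductSpace ℂ 𝓗]

lemma tsum_nnnorm_inner_sq {ι : Type*} (b : HilbertBasis ι ℂ 𝓗) (x : 𝓗) :
    ∑' i, (‖⟪b i, x⟫_ℂ‖₊ : ℝ≥0∞) ^ 2 = (‖x‖₊ : ℝ≥0∞) ^ 2 := by
  have h := (b.hasSum_inner_mul_inner x x).mapL (RCLike.reCLM (K := ℂ))
  have e1 : ∀ i, RCLike.reCLM (⟪x, b i⟫_ℂ * ⟪b i, x⟫_ℂ) = ‖⟪b i, x⟫_ℂ‖ ^ 2 := fun i => by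
    rw [← inner_conj_symm x (b i), RCLike.conj_mul, RCLike.reCLM_apply]
    exact_mod_cast RCLike.ofReal_re (K := ℂ) _
  have e2 : RCLike.reCLM ⟪x, x⟫_ℂ = ‖x‖ ^ 2 := by
    rw [RCLike.reCLM_apply, inner_self_eq_norm_sq_to_K]
    exact_mod_cast RCLike.ofReal_re (K := ℂ) _
  rw [e2] at h
  simp only [e1] at h
  have h2 : HasSum (fun i => ‖⟪b i, x⟫_ℂ‖₊ ^ 2) (‖x‖₊ ^ 2) := by
    rw [← NNReal.hasSum_coe]
    simpa only [NNReal.coe_pow, coe_nnnorm] using h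
  have := (ENNReal.hasSum_coe.2 h2).tsum_eq
  push_cast at this
  exact this

lemma tsum_le_trNorm (T : 𝓗 →L[ℂ] 𝓗) {ι : Type*} {v : ι → 𝓗} (hv : Orthonormal ℂ v) :
    ∑' i, (‖⟪v i, T (v i)⟫_ℂ‖₊ : ℝ≥0∞) ≤ trNorm T := by
  have hinj := hv.linearIndependent.injective
  refine le_trans (le_of_eq ?_) (le_iSup₂ (Set.range v) hv.toSubtypeRange)
  exact (Equiv.ofInjective v hinj).tsum_eq
    (fun x : Set.range v => (‖⟪(x : 𝓗), T x⟫_ℂ‖₊ : ℝ≥0∞))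

lemma nnnorm_inner_add {S T : 𝓗 →L[ℂ] 𝓗} (hS : 0 ≤ S) (hT : 0 ≤ T) (x : 𝓗) :
    (‖⟪x, (S + T) x⟫_ℂ‖₊ : ℝ≥0∞) = ‖⟪x, S x⟫_ℂ‖₊ + ‖⟪x, T x⟫_ℂ‖₊ := by
  rw [ContinuousLinearMap.nonneg_iff_isPositive] at hS hT
  have h1 := hS.inner_nonneg_right x
  have h2 := hT.inner_nonneg_right x
  have h3 := (hS.add hT).inner_nonneg_right x
  rw [← ENNReal.coe_add, ENNReal.coe_inj, ← NNReal.coe_inj, NNReal.coe_add, coe_nnnorm,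
    coe_nnnorm, coe_nnnorm, ← Complex.re_eq_norm.2 h1, ← Complex.re_eq_norm.2 h2,
    ← Complex.re_eq_norm.2 h3, ← Complex.add_re, ← inner_add_right]
  rfl

lemma trNorm_smul {c : ℝ} (hc : 0 ≤ c) (T : 𝓗 →L[ℂ] 𝓗) :
    trNorm (c • T) = ENNReal.ofReal c * trNorm T := by
  unfold trNorm
  simp only [ENNReal.mul_iSup, ← ENNReal.tsum_mul_left]
  refine iSup_congr fun s => iSup_congr fun _ => tsum_congr fun x => ?_
  have : ⟪(x : 𝓗), (c • T) x⟫_ℂ = (c : ℂ) * ⟪(x : 𝓗), T x⟫_ℂ := by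
    rw [← inner_smul_right]; rfl
  rw [this, nnnorm_mul, ENNReal.coe_mul, ENNReal.ofReal, Complex.nnnorm_real,
    Real.nnnorm_of_nonneg hc, Real.toNNReal_of_nonneg hc]

lemma nnnorm_inner_le_trNorm (T : 𝓗 →L[ℂ] 𝓗) {x : 𝓗} (hx : ‖x‖ = 1) :
    (‖⟪x, T x⟫_ℂ‖₊ : ℝ≥0∞) ≤ trNorm T := by
  have hv : Orthonormal ℂ (fun _ : Unit => x) :=
    ⟨fun _ => hx, fun i j h => (h (Subsingleton.elim _ _)).elim⟩
  simpa using tsum_le_trNorm T hv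

/-- The control at `p` may be replaced by the one at `min p (1 - p)`. -/
lemma IsLAA.symmetric {S0 : Set (𝓗 →L[ℂ] 𝓗)} {f : (𝓗 →L[ℂ] 𝓗) → EReal} {a b : ℝ → ℝ}
    (h : IsLAA S0 f a b) {ρ σ : 𝓗 →L[ℂ] 𝓗} (hρ : ρ ∈ S0) (hσ : σ ∈ S0)
    {p : ℝ} (hp0 : 0 ≤ p) (hp1 : p ≤ 1) :
    (p : EReal) * f ρ + ((1 - p : ℝ) : EReal) * f σ
        ≤ f (p • ρ + (1 - p) • σ) + (a (min p (1 - p)) : EReal) ∧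
      f (p • ρ + (1 - p) • σ)
        ≤ (p : EReal) * f ρ + ((1 - p : ℝ) : EReal) * f σ + (b (min p (1 - p)) : EReal) := by
  have key : ∀ q : ℝ, q = min p (1 - p) →
      ((p : EReal) * f ρ + ((1 - p : ℝ) : EReal) * f σ) - (a q : EReal)
          ≤ f (p • ρ + (1 - p) • σ) ∧
        f (p • ρ + (1 - p) • σ)
          ≤ ((p : EReal) * f ρ + ((1 - p : ℝ) : EReal) * f σ) + (b q : EReal) := by
    rintro q rfl
    rcases le_total p (1 - p) with hp | hp
    · rw [min_eq_left hp]
      exact h ρ hρ σ hσ p hp0 hp1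
    · rw [min_eq_right hp]
      have := h σ hσ ρ hρ (1 - p) (by linarith) (by linarith)
      rwa [sub_sub_cancel, add_comm ((1 - p) • σ), add_comm (((1 - p : ℝ) : EReal) * f σ)] at this
  obtain ⟨h1, h2⟩ := key _ rfl
  exact ⟨(EReal.sub_le_iff_le_add (.inl (EReal.coe_ne_bot _)) (.inl (EReal.coe_ne_top _))).1 h1, h2⟩

lemma homExt_of_isState {f : (𝓗 →L[ℂ] 𝓗) → EReal} {ϱ : 𝓗 →L[ℂ] 𝓗} (h : IsState ϱ) : homExt f ϱ = f ϱ := by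
  have hne : ϱ ≠ 0 := by
    rintro rfl
    have := h.2
    simp [trNorm] at this
  simp [homExt, hne, h.2]

variable [CompleteSpace 𝓗]

lemma cut_eq_sub_posPart {ρ : 𝓗 →L[ℂ] 𝓗} (hρ : 0 ≤ ρ) (ε : ℝ) :
    cut ρ ε = ρ - (ρ - algebraMap ℝ (𝓗 →L[ℂ] 𝓗) ε)⁺ := by
  have hs : IsSelfAdjoint ρ := .of_nonneg hρ
  have h1 : ρ - algebraMap ℝ (𝓗 →L[ℂ] 𝓗) ε = cfc (fun x : ℝ => x - ε) ρ := by
    rw [cfc_sub .., cfc_id' ℝ ρ, cfc_const ε ρ]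
  rw [h1, CFC.posPart_def, cfcₙ_eq_cfc, ← cfc_comp' ..]
  conv_rhs => enter [1]; rw [← cfc_id' ℝ ρ]
  rw [← cfc_sub .., cut]
  refine cfc_congr fun x _ => ?_
  simp only [_root_.posPart_def]
  rcases le_total x ε with h | h
  · rw [min_eq_left h, sup_eq_right.2 (by linarith)]; ring
  · rw [min_eq_right h, sup_eq_left.2 (by linarith)]; ring

/-- For a positive operator the quadratic form is `‖√T x‖²`. -/
lemma exists_sqrt {T : 𝓗 →L[ℂ] 𝓗} (hT : 0 ≤ T) :
    ∃ S : 𝓗 →L[ℂ] 𝓗, (∀ x y, ⟪S x, y⟫_ℂ = ⟪x, S y⟫_ℂ) ∧ S * S = T ∧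
      ∀ x, (‖⟪x, T x⟫_ℂ‖₊ : ℝ≥0∞) = (‖S x‖₊ : ℝ≥0∞) ^ 2 := by
  have hS : 0 ≤ CFC.sqrt T := CFC.sqrt_nonneg T
  have hsym := ((ContinuousLinearMap.nonneg_iff_isPositive _).1 hS).inner_left_eq_inner_right
  have hmul : CFC.sqrt T * CFC.sqrt T = T := CFC.sqrt_mul_sqrt_self T hT
  refine ⟨CFC.sqrt T, hsym, hmul, fun x => ?_⟩
  have : ⟪x, T x⟫_ℂ = ⟪CFC.sqrt T x, CFC.sqrt T x⟫_ℂ := by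
    rw [hsym]; nth_rw 1 [← hmul]; rfl
  rw [this, ← ENNReal.coe_pow, ENNReal.coe_inj]
  ext
  simp [inner_self_eq_norm_sq_to_K]

lemma tsum_hilbertBasis_eq {T : 𝓗 →L[ℂ] 𝓗} (hT : 0 ≤ T) {ι κ : Type*}
    (b : HilbertBasis ι ℂ 𝓗) (c : HilbertBasis κ ℂ 𝓗) :
    ∑' i, (‖⟪b i, T (b i)⟫_ℂ‖₊ : ℝ≥0∞) = ∑' j, (‖⟪c j, T (c j)⟫_ℂ‖₊ : ℝ≥0∞) := by
  obtain ⟨S, hsym, -, hS⟩ := exists_sqrt hT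
  simp only [hS]
  calc ∑' i, (‖S (b i)‖₊ : ℝ≥0∞) ^ 2
      = ∑' i, ∑' j, (‖⟪c j, S (b i)⟫_ℂ‖₊ : ℝ≥0∞) ^ 2 := by simp only [tsum_nnnorm_inner_sq]
    _ = ∑' j, ∑' i, (‖⟪c j, S (b i)⟫_ℂ‖₊ : ℝ≥0∞) ^ 2 := ENNReal.tsum_comm
    _ = ∑' j, ∑' i, (‖⟪b i, S (c j)⟫_ℂ‖₊ : ℝ≥0∞) ^ 2 := by
      congr! 6 with j i
      rw [← hsym, ← nnnorm_star, ← starRingEnd_apply, inner_conj_symm]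
    _ = ∑' j, (‖S (c j)‖₊ : ℝ≥0∞) ^ 2 := by simp only [tsum_nnnorm_inner_sq]

lemma trNorm_eq_tsum {T : 𝓗 →L[ℂ] 𝓗} (hT : 0 ≤ T) {ι : Type*} (b : HilbertBasis ι ℂ 𝓗) :
    trNorm T = ∑' i, (‖⟪b i, T (b i)⟫_ℂ‖₊ : ℝ≥0∞) := by
  refine le_antisymm (iSup₂_le fun s hs => ?_) (tsum_le_trNorm T b.orthonormal)
  obtain ⟨w, c, hsw, hc⟩ := hs.exists_hilbertBasis_extension
  rw [tsum_hilbertBasis_eq hT b c, hc]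
  exact ENNReal.tsum_comp_le_tsum_of_injective (Set.inclusion_injective hsw)
    (fun x : w => (‖⟪(x : 𝓗), T x⟫_ℂ‖₊ : ℝ≥0∞))

lemma trNorm_add {S T : 𝓗 →L[ℂ] 𝓗} (hS : 0 ≤ S) (hT : 0 ≤ T) :
    trNorm (S + T) = trNorm S + trNorm T := by
  obtain ⟨w, b, -⟩ := exists_hilbertBasis ℂ 𝓗
  rw [trNorm_eq_tsum (add_nonneg hS hT) b, trNorm_eq_tsum hS b, trNorm_eq_tsum hT b,
    ← ENNReal.tsum_add]
  exact tsum_congr fun i => nnnorm_inner_add hS hT _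

/-- An operator is bounded in the Loewner order by its trace norm. -/
lemma le_algebraMap_of_trNorm_le {T : 𝓗 →L[ℂ] 𝓗} (hT : 0 ≤ T) {ε : ℝ} (hε : 0 ≤ ε)
    (h : trNorm T ≤ ENNReal.ofReal ε) : T ≤ algebraMap ℝ (𝓗 →L[ℂ] 𝓗) ε := by
  have hsa : IsSelfAdjoint (algebraMap ℝ (𝓗 →L[ℂ] 𝓗) ε - T) :=
    (IsSelfAdjoint.of_nonneg (algebraMap_nonneg _ hε)).sub (.of_nonneg hT)
  rw [ContinuousLinearMap.le_def, ContinuousLinearMap.isPositive_def']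
  refine ⟨hsa, fun x => ?_⟩
  have key : (⟪T x, x⟫_ℂ).re ≤ ε * ‖x‖ ^ 2 := by
    rcases eq_or_ne x 0 with rfl | hx
    · simp
    have hx0 : ‖x‖ ≠ 0 := norm_ne_zero_iff.2 hx
    have h1 := (nnnorm_inner_le_trNorm T (x := ((‖x‖⁻¹ : ℝ) : ℂ) • x)
      (by rw [norm_smul]; simp [hx0])).trans h
    have h2 : ‖⟪((‖x‖⁻¹ : ℝ) : ℂ) • x, T (((‖x‖⁻¹ : ℝ) : ℂ) • x)⟫_ℂ‖ ≤ ε := by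
      rw [ENNReal.ofReal, ENNReal.coe_le_coe, Real.le_toNNReal_iff_coe_le hε] at h1
      exact h1
    rw [map_smul, inner_smul_left, inner_smul_right, norm_mul, norm_mul, Complex.conj_ofReal,
      Complex.norm_real, norm_inv, norm_norm] at h2
    calc (⟪T x, x⟫_ℂ).re ≤ ‖⟪T x, x⟫_ℂ‖ := Complex.re_le_norm _
      _ = ‖⟪x, T x⟫_ℂ‖ := norm_inner_symm _ _
      _ = (‖x‖⁻¹ * (‖x‖⁻¹ * ‖⟪x, T x⟫_ℂ‖)) * ‖x‖ ^ 2 := by field_simp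
      _ ≤ ε * ‖x‖ ^ 2 := by gcongr
  have hx : (algebraMap ℝ (𝓗 →L[ℂ] 𝓗) ε - T) x = (ε : ℂ) • x - T x := rfl
  rw [ContinuousLinearMap.reApplyInnerSelf_apply, hx, inner_sub_left, inner_smul_left,
    inner_self_eq_norm_sq_to_K, Complex.conj_ofReal, map_sub, sub_nonneg]
  refine key.trans (le_of_eq ?_)
  change _ = ((ε : ℂ) * ((‖x‖ : ℝ) : ℂ) ^ 2).re
  rw [← Complex.ofReal_pow, ← Complex.ofReal_mul, Complex.ofReal_re]

lemma eq_zero_of_trNorm_eq_zero {T : 𝓗 →L[ℂ] 𝓗} (hT : 0 ≤ T) (h : trNorm T = 0) : T = 0 :=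
  le_antisymm (by simpa using le_algebraMap_of_trNorm_le hT le_rfl (by simp [h])) hT

lemma trNorm_mono {S T : 𝓗 →L[ℂ] 𝓗} (hS : 0 ≤ S) (h : S ≤ T) : trNorm S ≤ trNorm T := by
  have := trNorm_add hS (sub_nonneg.2 h)
  rw [add_sub_cancel] at this
  exact this ▸ le_self_add

/-- The trace norm dominates the sum of the traces of two orthogonal positive parts. -/
lemma trNorm_add_le_trNorm_sub {P N : 𝓗 →L[ℂ] 𝓗} (hP : 0 ≤ P) (hN : 0 ≤ N) (hNP : N * P = 0) :
    trNorm P + trNorm N ≤ trNorm (P - N) := by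
  let K : Submodule ℂ 𝓗 := LinearMap.ker (N : 𝓗 →ₗ[ℂ] 𝓗)
  have hKc : IsClosed (K : Set 𝓗) := N.isClosed_ker
  have : CompleteSpace K := hKc.completeSpace_coe
  obtain ⟨w, b, -⟩ := exists_hilbertBasis ℂ K
  have hb : Orthonormal ℂ (fun i => (b i : 𝓗)) := b.orthonormal.comp_linearIsometry K.subtypeₗᵢ
  obtain ⟨u, c, hu, hc⟩ := hb.toSubtypeRange.exists_hilbertBasis_extension
  have hsym := ((ContinuousLinearMap.nonneg_iff_isPositive _).1 hP).inner_left_eq_inner_right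
  have hcases : ∀ i, N (c i) = 0 ∨ P (c i) = 0 := by
    intro i
    by_cases hi : (c i) ∈ Set.range (fun i => (b i : 𝓗))
    · obtain ⟨j, hj⟩ := hi
      exact Or.inl (hj ▸ (b j).2)
    · right
      have horth : ∀ k : K, ⟪c i, (k : 𝓗)⟫_ℂ = 0 := by
        intro k
        have h1 := (b.hasSum_repr k).mapL (innerSL ℂ (c i) ∘L K.subtypeL)
        refine h1.unique ?_
        convert hasSum_zero with j
        have hj : (b j : 𝓗) ∈ u := hu ⟨j, rfl⟩
        have hne : i ≠ ⟨_, hj⟩ := by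
          rintro rfl
          exact hi ⟨j, by rw [hc]⟩
        have := c.orthonormal.2 hne
        rw [hc] at this
        simp [hc, this]
      have hmem : P (P (c i)) ∈ K := by
        change (N * P) (P (c i)) = 0
        rw [hNP]; rfl
      rw [← inner_self_eq_zero (𝕜 := ℂ), hsym]
      exact horth ⟨_, hmem⟩
  rw [trNorm_eq_tsum hP c, trNorm_eq_tsum hN c, ← ENNReal.tsum_add]
  refine le_trans (ENNReal.tsum_le_tsum fun i => ?_) (tsum_le_trNorm (P - N) c.orthonormal)
  have hsub : (P - N) (c i) = P (c i) - N (c i) := rfl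
  rcases hcases i with h | h <;> simp [hsub, h]

section Control

variable {a : ℝ → ℝ}

lemma nonneg_up (h0 : a 0 = 0) (hm : MonotoneOn a (Set.Icc 0 (1 / 2))) {ε : ℝ} (hε : 0 ≤ ε) :
    0 ≤ up a ε := by
  unfold up
  rw [← h0]
  split_ifs with h
  · exact hm (by norm_num) ⟨hε, h⟩ hε
  · exact hm (by norm_num) (by norm_num) (by norm_num)

/-- Rescaled control functions are bounded by their monotone modification. -/
lemma mul_control_le_up (h0 : a 0 = 0) (hc : ConcaveOn ℝ (Set.Icc 0 (1 / 2)) a)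
    (hm : MonotoneOn a (Set.Icc 0 (1 / 2))) {α β ε : ℝ} (hα : 0 ≤ α) (hβ : 0 ≤ β)
    (hs : α + β ≤ 1) (hε : α ≤ ε) :
    (α + β) * a (min α β / (α + β)) ≤ up a ε := by
  rcases (add_nonneg hα hβ).eq_or_lt with h | h
  · rw [← h, zero_mul]
    exact nonneg_up h0 hm (hα.trans hε)
  have hm0 : 0 ≤ min α β := le_min hα hβ
  have hm2 : 2 * min α β ≤ α + β := by
    linarith [min_le_left α β, min_le_right α β]
  have hx : min α β / (α + β) ∈ Set.Icc (0 : ℝ) (1 / 2) :=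
    ⟨by positivity, by rw [div_le_iff₀ h]; linarith⟩
  have h1 := hc.2 hx (show (0 : ℝ) ∈ Set.Icc (0 : ℝ) (1 / 2) by norm_num) h.le
    (sub_nonneg.2 hs) (by ring)
  simp only [smul_eq_mul, h0, mul_zero, add_zero, mul_div_cancel₀ _ h.ne'] at h1
  refine h1.trans ?_
  have hmin : min α β ∈ Set.Icc (0 : ℝ) (1 / 2) := ⟨hm0, by linarith⟩
  unfold up
  split_ifs with h2
  · exact hm hmin ⟨hα.trans hε, h2⟩ ((min_le_left _ _).trans hε)
  · exact hm hmin (by norm_num) hmin.2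

end Control

/-- `T` lies below, and commutes with, an element of `S0`. -/
def Dominated (S0 : Set (𝓗 →L[ℂ] 𝓗)) (T : 𝓗 →L[ℂ] 𝓗) : Prop :=
  0 ≤ T ∧ ∃ ϱ ∈ S0, T ≤ ϱ ∧ ϱ * T = T * ϱ

section Homogeneous

variable {S0 : Set (𝓗 →L[ℂ] 𝓗)} {f : (𝓗 →L[ℂ] 𝓗) → EReal} {a b : ℝ → ℝ}

lemma Dominated.trNorm_ne_top (hS0 : S0 ⊆ {ϱ | IsState ϱ}) {T : 𝓗 →L[ℂ] 𝓗}
    (hT : Dominated S0 T) : trNorm T ≠ ⊤ := by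
  obtain ⟨h0, ϱ, hϱ, hle, -⟩ := hT
  exact ((trNorm_mono h0 hle).trans_lt ((hS0 hϱ).2 ▸ ENNReal.one_lt_top)).ne

lemma Dominated.toReal_pos (hS0 : S0 ⊆ {ϱ | IsState ϱ}) {T : 𝓗 →L[ℂ] 𝓗}
    (hT : Dominated S0 T) (hne : T ≠ 0) : 0 < (trNorm T).toReal :=
  ENNReal.toReal_pos (fun h => hne (eq_zero_of_trNorm_eq_zero hT.1 h)) (hT.trNorm_ne_top hS0)

lemma Dominated.normalize_mem (hS0 : S0 ⊆ {ϱ | IsState ϱ})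
    (hSprop : ∀ ϱ ∈ S0, ∀ ς : 𝓗 →L[ℂ] 𝓗, IsState ς →
      (∃ c : ℝ, 0 < c ∧ c • ς ≤ ϱ) → ϱ * ς = ς * ϱ → ς ∈ S0)
    {T : 𝓗 →L[ℂ] 𝓗} (hT : Dominated S0 T) (hne : T ≠ 0) :
    (trNorm T).toReal⁻¹ • T ∈ S0 := by
  have ht := hT.toReal_pos hS0 hne
  have hfin := hT.trNorm_ne_top hS0
  obtain ⟨h0, ϱ, hϱ, hle, hcomm⟩ := hT
  refine hSprop ϱ hϱ _ ⟨?_, ?_⟩ ⟨_, ht, ?_⟩ ?_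
  · exact (ContinuousLinearMap.nonneg_iff_isPositive _).1 (smul_nonneg (inv_nonneg.2 ht.le) h0)
  · rw [trNorm_smul (inv_nonneg.2 ht.le)]
    nth_rw 2 [← ENNReal.ofReal_toReal hfin]
    rw [← ENNReal.ofReal_mul (inv_nonneg.2 ht.le), inv_mul_cancel₀ ht.ne', ENNReal.ofReal_one]
  · rwa [smul_smul, mul_inv_cancel₀ ht.ne', one_smul]
  · rw [mul_smul_comm, smul_mul_assoc, hcomm]

lemma Dominated.homExt_eq (hS0 : S0 ⊆ {ϱ | IsState ϱ}) {T : 𝓗 →L[ℂ] 𝓗}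
    (hT : Dominated S0 T) (hne : T ≠ 0) :
    homExt f T = ((trNorm T).toReal : EReal) * f ((trNorm T).toReal⁻¹ • T) := by
  rw [homExt, if_neg hne, EReal.coe_ennreal_toReal (hT.trNorm_ne_top hS0)]

lemma Dominated.homExt_nonneg (hS0 : S0 ⊆ {ϱ | IsState ϱ})
    (hSprop : ∀ ϱ ∈ S0, ∀ ς : 𝓗 →L[ℂ] 𝓗, IsState ς →
      (∃ c : ℝ, 0 < c ∧ c • ς ≤ ϱ) → ϱ * ς = ς * ϱ → ς ∈ S0)
    (hnonneg : ∀ ϱ ∈ S0, 0 ≤ f ϱ) {T : 𝓗 →L[ℂ] 𝓗} (hT : Dominated S0 T) :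
    0 ≤ homExt f T := by
  by_cases hne : T = 0
  · simp [homExt, hne]
  rw [hT.homExt_eq hS0 hne]
  exact mul_nonneg (EReal.coe_nonneg.2 ENNReal.toReal_nonneg)
    (hnonneg _ (hT.normalize_mem hS0 hSprop hne))

/-- The homogeneous extension of an LAA function is almost additive. -/
lemma homExt_add (hS0 : S0 ⊆ {ϱ | IsState ϱ})
    (hSprop : ∀ ϱ ∈ S0, ∀ ς : 𝓗 →L[ℂ] 𝓗, IsState ς →
      (∃ c : ℝ, 0 < c ∧ c • ς ≤ ϱ) → ϱ * ς = ς * ϱ → ς ∈ S0)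
    (hab : ControlPair a b) (hLAA : IsLAA S0 f a b)
    {A B : 𝓗 →L[ℂ] 𝓗} (hA : Dominated S0 A) (hB : Dominated S0 B)
    (hAB : Dominated S0 (A + B)) {ε : ℝ} (hle : trNorm (A + B) ≤ 1)
    (hε0 : 0 ≤ ε) (hε : trNorm A ≤ ENNReal.ofReal ε) :
    homExt f A + homExt f B ≤ homExt f (A + B) + (up a ε : EReal) ∧
      homExt f (A + B) ≤ homExt f A + homExt f B + (up b ε : EReal) := by
  have hua : (0 : EReal) ≤ up a ε := EReal.coe_nonneg.2 (nonneg_up hab.zeroa hab.mona hε0)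
  have hub : (0 : EReal) ≤ up b ε := EReal.coe_nonneg.2 (nonneg_up hab.zerob hab.monb hε0)
  have hz : homExt f 0 = 0 := if_pos rfl
  by_cases hA0 : A = 0
  · subst hA0
    simp only [zero_add, hz]
    exact ⟨le_add_of_nonneg_right hua, le_add_of_nonneg_right hub⟩
  by_cases hB0 : B = 0
  · subst hB0
    simp only [add_zero, hz]
    exact ⟨le_add_of_nonneg_right hua, le_add_of_nonneg_right hub⟩
  have hα := hA.toReal_pos hS0 hA0
  have hβ := hB.toReal_pos hS0 hB0
  have hst : (trNorm (A + B)).toReal = (trNorm A).toReal + (trNorm B).toReal := by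
    rw [trNorm_add hA.1 hB.1, ENNReal.toReal_add (hA.trNorm_ne_top hS0) (hB.trNorm_ne_top hS0)]
  have hne : A + B ≠ 0 := by
    intro h
    rw [h] at hst
    have : (trNorm (0 : 𝓗 →L[ℂ] 𝓗)).toReal = 0 := by simp [trNorm]
    linarith
  have hxA := hA.normalize_mem hS0 hSprop hA0
  have hxB := hB.normalize_mem hS0 hSprop hB0
  have hαε : (trNorm A).toReal ≤ ε := ENNReal.toReal_le_of_le_ofReal hε0 hε
  have hs1 : (trNorm A).toReal + (trNorm B).toReal ≤ 1 := by
    rw [← hst]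
    simpa using ENNReal.toReal_mono ENNReal.one_ne_top hle
  rw [hAB.homExt_eq hS0 hne, hA.homExt_eq hS0 hA0, hB.homExt_eq hS0 hB0, hst]
  set α := (trNorm A).toReal
  set β := (trNorm B).toReal
  have hs : 0 < α + β := add_pos hα hβ
  have hq : 1 - α / (α + β) = β / (α + β) := by field_simp; ring
  obtain ⟨h1, h2⟩ := hLAA.symmetric hxA hxB (p := α / (α + β)) (by positivity)
    (by rw [div_le_one hs]; linarith)
  have hmin : min (α / (α + β)) (β / (α + β)) = min α β / (α + β) :=
    (min_div_div_right hs.le α β)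
  have hz : (α / (α + β)) • α⁻¹ • A + (β / (α + β)) • β⁻¹ • B = (α + β)⁻¹ • (A + B) := by
    rw [smul_smul, smul_smul, smul_add]
    congr 2 <;> field_simp
  rw [hq, hz, hmin] at h1 h2
  have hs' : (0 : EReal) ≤ ((α + β : ℝ) : EReal) := EReal.coe_nonneg.2 hs.le
  have hdist : ∀ u v : EReal, ((α + β : ℝ) : EReal) * (u + v) =
      ((α + β : ℝ) : EReal) * u + ((α + β : ℝ) : EReal) * v := fun u v =>
    EReal.left_distrib_of_nonneg_of_ne_top hs' (EReal.coe_ne_top _) u v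
  have hmul : ∀ (t : ℝ) (u : EReal),
      ((α + β : ℝ) : EReal) * (((t / (α + β) : ℝ) : EReal) * u) = (t : EReal) * u := fun t u => by
    rw [← mul_assoc, ← EReal.coe_mul, mul_div_cancel₀ _ hs.ne']
  have h1' := mul_le_mul_of_nonneg_left h1 hs'
  have h2' := mul_le_mul_of_nonneg_left h2 hs'
  simp only [hdist, hmul, ← EReal.coe_mul] at h1' h2'
  refine ⟨h1'.trans ?_, h2'.trans ?_⟩
  · gcongr
    exact mul_control_le_up hab.zeroa hab.cva hab.mona hα.le hβ.le hs1 hαε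
  · gcongr
    exact mul_control_le_up hab.zerob hab.cvb hab.monb hα.le hβ.le hs1 hαε

end Homogeneous

end AFW

namespace AFW

/-- advanced commutative AFW lemma, part A: semicontinuity bound. -/
theorem stmt1
    {𝓗 : Type*} [NormedAddCommGroup 𝓗] [InnerProductSpace ℂ 𝓗] [CompleteSpace 𝓗]
    (S0 : Set (𝓗 →L[ℂ] 𝓗)) (hS0 : S0 ⊆ {ϱ | IsState ϱ}) (hconv : Convex ℝ S0)
    (hSprop : ∀ ϱ ∈ S0, ∀ ς : 𝓗 →L[ℂ] 𝓗, IsState ς →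
      (∃ c : ℝ, 0 < c ∧ c • ς ≤ ϱ) → ϱ * ς = ς * ϱ → ς ∈ S0)
    (f : (𝓗 →L[ℂ] 𝓗) → EReal) (a b : ℝ → ℝ) (hab : ControlPair a b)
    (hnonneg : ∀ ϱ ∈ S0, 0 ≤ f ϱ) (hLAA : IsLAA S0 f a b)
    (ρ : 𝓗 →L[ℂ] 𝓗) (hρ : ρ ∈ S0) (hfρ : f ρ ≠ ⊤)
    (σ : 𝓗 →L[ℂ] 𝓗) (hσ : σ ∈ S0) (hcomm : ρ * σ = σ * ρ)
    (ε : ℝ) (hε0 : 0 ≤ ε) (hε1 : ε ≤ 1)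
    (hdist : trNorm (ρ - σ) ≤ ENNReal.ofReal (2 * ε)) :
    f ρ - f σ ≤ homExt f (cut ρ ε) + ((2 * up a ε + up b ε : ℝ) : EReal) := by
  have hsρ : IsState ρ := hS0 hρ
  have hsσ : IsState σ := hS0 hσ
  have hρ0 : 0 ≤ ρ := (ContinuousLinearMap.nonneg_iff_isPositive _).2 hsρ.1
  have hσ0 : 0 ≤ σ := (ContinuousLinearMap.nonneg_iff_isPositive _).2 hsσ.1
  have hcomm' : Commute ρ σ := hcomm
  have hsa : IsSelfAdjoint (ρ - σ) := (IsSelfAdjoint.of_nonneg hρ0).sub (.of_nonneg hσ0)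
  obtain ⟨P, hP⟩ : ∃ P, P = (ρ - σ)⁺ := ⟨_, rfl⟩
  obtain ⟨N, hN⟩ : ∃ N, N = (ρ - σ)⁻ := ⟨_, rfl⟩
  have hP0 : 0 ≤ P := hP ▸ CFC.posPart_nonneg _
  have hN0 : 0 ≤ N := hN ▸ CFC.negPart_nonneg _
  have hPN : P - N = ρ - σ := by rw [hP, hN, CFC.posPart_sub_negPart _ hsa]
  have hNP : N * P = 0 := by rw [hP, hN, CFC.negPart_mul_posPart]
  have hPρ : P ≤ ρ := hP ▸ posPart_sub_le_left hρ0 hσ0 hcomm'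
  have hNσ : N ≤ σ := by
    rw [hN, ← CFC.posPart_neg, neg_sub]
    exact posPart_sub_le_left hσ0 hρ0 hcomm'.symm
  have hcP : Commute ρ P := by
    rw [hP, CFC.posPart_def]
    exact (Commute.cfcₙ_real ((Commute.refl ρ).sub_left hcomm'.symm) _).symm
  have hcN : Commute σ N := by
    rw [hN, CFC.negPart_def]
    exact (Commute.cfcₙ_real (hcomm'.sub_left (Commute.refl σ)) _).symm
  have htr : trNorm P = trNorm N := by
    have h1 := trNorm_add hP0 hσ0
    have h2 := trNorm_add hN0 hρ0
    rw [show P + σ = N + ρ by rw [← sub_eq_zero, ← sub_eq_zero.2 hPN]; abel, h2, hsρ.2,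
      hsσ.2] at h1
    exact ((ENNReal.add_left_inj ENNReal.one_ne_top).1 h1).symm
  have hPε : trNorm P ≤ ENNReal.ofReal ε := by
    have h1 := (trNorm_add_le_trNorm_sub hP0 hN0 hNP).trans (hPN ▸ hdist)
    rw [← htr, ← two_mul, ENNReal.ofReal_mul zero_le_two, ENNReal.ofReal_ofNat] at h1
    exact (ENNReal.mul_le_mul_iff_right two_ne_zero ENNReal.ofNat_ne_top).1 h1
  have hcut : cut ρ ε = ρ - (ρ - algebraMap ℝ (𝓗 →L[ℂ] 𝓗) ε)⁺ := cut_eq_sub_posPart hρ0 ε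
  have hPcut : P ≤ cut ρ ε := by
    have hle := le_algebraMap_of_trNorm_le hP0 hε0 hPε
    have hc : Commute (ρ - P) (algebraMap ℝ (𝓗 →L[ℂ] 𝓗) ε - P) :=
      ((Algebra.commute_algebraMap_right ε _).sub_right
        (hcP.sub_left (Commute.refl P)))
    have := posPart_sub_le_left (sub_nonneg.2 hPρ) (sub_nonneg.2 hle) hc
    rw [sub_sub_sub_cancel_right] at this
    rw [hcut]
    exact le_sub_comm.1 this
  have hcutρ : cut ρ ε ≤ ρ := by
    rw [hcut]
    exact sub_le_self _ (CFC.posPart_nonneg _)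
  have hcc : Commute ρ (cut ρ ε) := (Commute.cfc_real (Commute.refl ρ) _).symm
  have dP : Dominated S0 P := ⟨hP0, ρ, hρ, hPρ, hcP⟩
  have dN : Dominated S0 N := ⟨hN0, σ, hσ, hNσ, hcN⟩
  have dM : Dominated S0 (ρ - P) :=
    ⟨sub_nonneg.2 hPρ, ρ, hρ, sub_le_self _ hP0, (Commute.refl ρ).sub_right hcP⟩
  have dcut : Dominated S0 (cut ρ ε) := ⟨hP0.trans hPcut, ρ, hρ, hcutρ, hcc⟩
  have dR : Dominated S0 (cut ρ ε - P) :=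
    ⟨sub_nonneg.2 hPcut, ρ, hρ, (sub_le_self _ hP0).trans hcutρ, hcc.sub_right hcP⟩
  have dρ : Dominated S0 ρ := ⟨hρ0, ρ, hρ, le_rfl, rfl⟩
  have dσ : Dominated S0 σ := ⟨hσ0, σ, hσ, le_rfl, rfl⟩
  have eρ : P + (ρ - P) = ρ := add_sub_cancel _ _
  have eσ : N + (ρ - P) = σ := by
    rw [← sub_eq_zero, ← sub_eq_zero.2 hPN.symm]; abel
  have ec : P + (cut ρ ε - P) = cut ρ ε := add_sub_cancel _ _
  have h1 := (homExt_add hS0 hSprop hab hLAA dP dM (eρ.symm ▸ dρ)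
    (eρ.symm ▸ hsρ.2.le) hε0 hPε).2
  have h2 := (homExt_add hS0 hSprop hab hLAA dN dM (eσ.symm ▸ dσ)
    (eσ.symm ▸ hsσ.2.le) hε0 (htr ▸ hPε)).1
  have h3 := (homExt_add hS0 hSprop hab hLAA dP dR (ec.symm ▸ dcut)
    (ec.symm ▸ (trNorm_mono dcut.1 hcutρ).trans hsρ.2.le) hε0 hPε).1
  rw [eρ, homExt_of_isState hsρ] at h1
  rw [eσ, homExt_of_isState hsσ] at h2
  rw [ec] at h3
  have h2' := (le_add_of_nonneg_left (dN.homExt_nonneg hS0 hSprop hnonneg)).trans h2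
  have h3' := (le_add_of_nonneg_right (dR.homExt_nonneg hS0 hSprop hnonneg)).trans h3
  refine EReal.sub_le_of_le_add ?_
  calc f ρ ≤ homExt f P + homExt f (ρ - P) + (up b ε : EReal) := h1
    _ ≤ (homExt f (cut ρ ε) + (up a ε : EReal)) + (f σ + (up a ε : EReal)) + (up b ε : EReal) := by
      gcongr
    _ = homExt f (cut ρ ε) + ((2 * up a ε + up b ε : ℝ) : EReal) + f σ := by
      rw [two_mul, EReal.coe_add, EReal.coe_add]
      abel

end AFW
end
end
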